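/- For every λ̄ ≥ 8π there exist α₁ > 0 and C > 0, depending only on λ̄, such that for every α ∈ (0, α₁], every λ ∈ (0, λ̄], and every solution u of P(λ, ω_α) with ℰ(u) ≤ 1, one has |ℰ(u) − α/(8π) − α²λ/(48π²)| ≤ C α³. -/

import Mathlib

open MeasureTheory Real Set Filter

noncomputable section

/-- The Euclidean plane ℝ². -/
abbrev R2 : Type := EuclideanSpace ℝ (Fin 2)

/-- The Laplacian of `u : R2 → ℝ`: the sum of the second derivatives of `u`
along the two coordinate axes. -/
def lap (u : R2 → ℝ) (p : R2) : ℝ :=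
  ∑ i : Fin 2, iteratedDeriv 2 (fun t : ℝ => u (p + t • EuclideanSpace.single i (1 : ℝ))) 0

/-- `u` is a solution of the mean field problem `P(λ, Ω)`:
`u ∈ C²(Ω) ∩ C⁰(cl Ω)`, `u = 0` on `∂Ω` and `-Δu = λ eᵘ / ∫_Ω eᵘ` in `Ω`. -/
def IsSolP (Ω : Set R2) (lam : ℝ) (u : R2 → ℝ) : Prop :=
  ContDiffOn ℝ 2 u Ω ∧ ContinuousOn u (closure Ω) ∧
    (∀ p ∈ frontier Ω, u p = 0) ∧
    ∀ p ∈ Ω, -lap u p = lam * Real.exp (u p) / ∫ q in Ω, Real.exp (u q)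

/-- The open ellipse `ω_α = {α²x² + y² < 1}` with semi-axes `1/α` and `1`. -/
def ellipseO (α : ℝ) : Set R2 := {p | α ^ 2 * p 0 ^ 2 + p 1 ^ 2 < 1}

/-- The energy `ℰ(u) = (1/(2λ)) ∫_Ω δ(u) u` where `δ(u) = eᵘ / ∫_Ω eᵘ`. -/
def energyE (Ω : Set R2) (lam : ℝ) (u : R2 → ℝ) : ℝ :=
  (1 / (2 * lam)) * ∫ p in Ω, (Real.exp (u p) / ∫ q in Ω, Real.exp (u q)) * u p

open scoped Topology ContDiff

/-- The function `u` restricted to the line through `p` in the direction of the `i`-th axis. -/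
def axisLine (u : R2 → ℝ) (p : R2) (i : Fin 2) (t : ℝ) : ℝ :=
  u (p + t • EuclideanSpace.single i (1 : ℝ))

lemma lap_eq_sum_deriv (u : R2 → ℝ) (p : R2) :
    lap u p = ∑ i : Fin 2, deriv (deriv (axisLine u p i)) 0 := by
  simp only [lap, iteratedDeriv_succ, iteratedDeriv_zero]
  rfl

lemma contDiffAt_axisLine {u : R2 → ℝ} {p : R2} (hu : ContDiffAt ℝ 2 u p) (i : Fin 2) :
    ContDiffAt ℝ 2 (axisLine u p i) 0 := by
  unfold axisLine
  refine ContDiffAt.comp (0 : ℝ) (g := u) ?_ (by fun_prop)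
  simpa using hu

lemma tendsto_axis (p : R2) (i : Fin 2) :
    Tendsto (fun t : ℝ => p + t • EuclideanSpace.single i (1 : ℝ)) (𝓝 0) (𝓝 p) := by
  have : Continuous (fun t : ℝ => p + t • (EuclideanSpace.single i (1 : ℝ) : R2)) := by fun_prop
  simpa using this.tendsto 0

lemma lap_sub {u v : R2 → ℝ} {p : R2} (hu : ContDiffAt ℝ 2 u p) (hv : ContDiffAt ℝ 2 v p) :
    lap (fun q => u q - v q) p = lap u p - lap v p := by
  simp only [lap, ← Finset.sum_sub_distrib]
  refine Finset.sum_congr rfl fun i _ => ?_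
  exact iteratedDeriv_fun_sub (contDiffAt_axisLine hu i) (contDiffAt_axisLine hv i)

lemma deriv_deriv_nonpos_of_isLocalMax {f : ℝ → ℝ} {a : ℝ} (hf : ContinuousAt f a)
    (h : IsLocalMax f a) : deriv (deriv f) a ≤ 0 := by
  by_contra! hpos
  have hmin := isLocalMin_of_deriv_deriv_pos hpos h.deriv_eq_zero hf
  have hconst : f =ᶠ[𝓝 a] fun _ => f a := by
    filter_upwards [h, hmin] with x hx hx' using le_antisymm hx hx'
  have : deriv (deriv f) a = 0 := by
    rw [hconst.deriv.deriv_eq]; simp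
  linarith

lemma lap_nonpos_of_isLocalMax {u : R2 → ℝ} {p : R2} (hu : ContinuousAt u p)
    (h : IsLocalMax u p) : lap u p ≤ 0 := by
  rw [lap_eq_sum_deriv]
  refine Finset.sum_nonpos fun i _ => deriv_deriv_nonpos_of_isLocalMax ?_ ?_
  · unfold axisLine
    refine ContinuousAt.comp (x := (0 : ℝ)) (g := u) (by simpa using hu) (by fun_prop)
  · have := (tendsto_axis p i).eventually h
    simpa [IsLocalMax, IsMaxFilter, axisLine] using this

/-- Comparison principle for the Laplacian with a strict differential inequality. -/
lemma le_of_lap_lt {Ω : Set R2} (ho : IsOpen Ω) (hb : Bornology.IsBounded Ω) {v w : R2 → ℝ}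
    (hv : ContDiffOn ℝ 2 v Ω) (hw : ContDiffOn ℝ 2 w Ω)
    (hvc : ContinuousOn v (closure Ω)) (hwc : ContinuousOn w (closure Ω))
    (hbd : ∀ p ∈ frontier Ω, v p ≤ w p) (hlap : ∀ p ∈ Ω, lap w p < lap v p) :
    ∀ p ∈ closure Ω, v p ≤ w p := by
  intro p hp
  obtain ⟨q, hq, hmax⟩ := hb.isCompact_closure.exists_isMaxOn ⟨p, hp⟩ (hvc.sub hwc)
  have hpq : v p - w p ≤ v q - w q := hmax hp
  by_cases hqΩ : q ∈ Ω
  · have hv' := hv.contDiffAt (ho.mem_nhds hqΩ)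
    have hw' := hw.contDiffAt (ho.mem_nhds hqΩ)
    have hloc : IsLocalMax (fun x => v x - w x) q :=
      (hmax.on_subset subset_closure).isLocalMax (ho.mem_nhds hqΩ)
    have : lap (fun x => v x - w x) q ≤ 0 :=
      lap_nonpos_of_isLocalMax (hv'.continuousAt.sub hw'.continuousAt) hloc
    rw [lap_sub hv' hw'] at this
    linarith [hlap q hqΩ]
  · have : q ∈ frontier Ω := by
      rw [ho.frontier_eq]; exact ⟨hq, hqΩ⟩
    linarith [hbd q this]

/-- The quadratic polynomial vanishing on the boundary of the ellipse `ω_α`. -/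
def ellipseFun (α : ℝ) (p : R2) : ℝ := 1 - α ^ 2 * p 0 ^ 2 - p 1 ^ 2

lemma mem_ellipseO {α : ℝ} {p : R2} : p ∈ ellipseO α ↔ 0 < ellipseFun α p := by
  simp only [ellipseO, ellipseFun, Set.mem_ofPred_eq]
  constructor <;> intro h <;> linarith

lemma continuous_ellipseFun (α : ℝ) : Continuous (ellipseFun α) := by
  unfold ellipseFun; fun_prop

lemma isOpen_ellipseO (α : ℝ) : IsOpen (ellipseO α) := by
  have : ellipseO α = {p | 0 < ellipseFun α p} := by ext p; exact mem_ellipseO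
  rw [this]
  exact isOpen_lt continuous_const (continuous_ellipseFun α)

lemma isBounded_ellipseO {α : ℝ} (hα : 0 < α) : Bornology.IsBounded (ellipseO α) := by
  refine (Metric.isBounded_closedBall (x := (0 : R2)) (r := 1 / α + 1)).subset fun p hp => ?_
  have hp : α ^ 2 * p 0 ^ 2 + p 1 ^ 2 < 1 := hp
  rw [mem_closedBall_zero_iff, EuclideanSpace.norm_eq, Real.sqrt_le_left (by positivity)]
  simp only [Fin.sum_univ_two, Real.norm_eq_abs, sq_abs]
  have h0 : p 0 ^ 2 ≤ (1 / α) ^ 2 := by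
    rw [div_pow, one_pow, le_div_iff₀ (by positivity)]
    nlinarith [sq_nonneg (p 1)]
  have h1 : p 1 ^ 2 ≤ 1 := by nlinarith [mul_nonneg (sq_nonneg α) (sq_nonneg (p 0))]
  have : 0 < 1 / α := by positivity
  nlinarith

lemma ellipseFun_eq_zero_of_mem_frontier {α : ℝ} {p : R2} (hp : p ∈ frontier (ellipseO α)) :
    ellipseFun α p = 0 := by
  rw [(isOpen_ellipseO α).frontier_eq] at hp
  refine le_antisymm (not_lt.1 fun h => hp.2 (mem_ellipseO.2 h)) ?_
  have : closure (ellipseO α) ⊆ {p | 0 ≤ ellipseFun α p} :=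
    closure_minimal (fun q hq => (mem_ellipseO.1 hq).le)
      (isClosed_le continuous_const (continuous_ellipseFun α))
  exact this hp.1

/-- The explicit barrier: `a` times the torsion function, plus `b` times an approximate solution
of `-Δφ = s / 2`, where `s = ellipseFun α`. -/
def barrier (α a b : ℝ) (p : R2) : ℝ :=
  a * (ellipseFun α p / 2) +
    b * ((5 * ellipseFun α p ^ 2 + 4 * ellipseFun α p * p 1 ^ 2) / 24)

lemma contDiff_barrier (α a b : ℝ) : ContDiff ℝ 2 (barrier α a b) := by
  unfold barrier ellipseFun; fun_prop

lemma barrier_eq_zero_of_mem_frontier {α a b : ℝ} {p : R2} (hp : p ∈ frontier (ellipseO α)) :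
    barrier α a b p = 0 := by
  simp [barrier, ellipseFun_eq_zero_of_mem_frontier hp]

lemma deriv_deriv_poly (c₀ c₁ c₂ c₃ c₄ : ℝ) :
    deriv (deriv fun t : ℝ => c₀ + c₁ * t + c₂ * t ^ 2 + c₃ * t ^ 3 + c₄ * t ^ 4) 0 = 2 * c₂ := by
  have h1 : deriv (fun t : ℝ => c₀ + c₁ * t + c₂ * t ^ 2 + c₃ * t ^ 3 + c₄ * t ^ 4) =
      fun t => c₁ + c₂ * (2 * t) + c₃ * (3 * t ^ 2) + c₄ * (4 * t ^ 3) := by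
    funext t
    have h2 := (hasDerivAt_pow 2 t).const_mul c₂
    have h3 := (hasDerivAt_pow 3 t).const_mul c₃
    have h4 := (hasDerivAt_pow 4 t).const_mul c₄
    have := (((((hasDerivAt_id t).const_mul c₁).const_add c₀).add h2).add h3).add h4
    refine Eq.trans this.deriv ?_
    norm_num
  rw [h1]
  have h2 := ((hasDerivAt_id (0 : ℝ)).const_mul 2).const_mul c₂
  have h3 := ((hasDerivAt_pow 2 (0 : ℝ)).const_mul 3).const_mul c₃
  have h4 := ((hasDerivAt_pow 3 (0 : ℝ)).const_mul 4).const_mul c₄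
  have := ((h2.const_add c₁).add h3).add h4
  refine Eq.trans (this.deriv) ?_
  norm_num
  ring

lemma lap_barrier (α a b : ℝ) (p : R2) :
    lap (barrier α a b) p = -a * (1 + α ^ 2) + b * (-(ellipseFun α p / 2) +
      α ^ 2 * (40 * (α ^ 2 * p 0 ^ 2) - 20 * ellipseFun α p - 8 * p 1 ^ 2) / 24) := by
  rw [lap_eq_sum_deriv, Fin.sum_univ_two]
  set x := p 0 with hx
  set y := p 1 with hy
  have e0 : axisLine (barrier α a b) p 0 = fun t =>
      barrier α a b p + (-a * α ^ 2 * x + b * (-20 * (1 - α ^ 2 * x ^ 2 - y ^ 2) * α ^ 2 * x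
        - 8 * α ^ 2 * x * y ^ 2) / 24) * t
      + (-a * α ^ 2 / 2 + b * (-10 * (1 - α ^ 2 * x ^ 2 - y ^ 2) * α ^ 2 + 20 * α ^ 4 * x ^ 2
        - 4 * α ^ 2 * y ^ 2) / 24) * t ^ 2
      + (b * (20 * α ^ 4 * x) / 24) * t ^ 3 + (b * 5 * α ^ 4 / 24) * t ^ 4 := by
    funext t
    simp [axisLine, barrier, ellipseFun, ← hx, ← hy]
    ring
  have e1 : axisLine (barrier α a b) p 1 = fun t =>
      barrier α a b p + (-a * y + b * (-20 * (1 - α ^ 2 * x ^ 2 - y ^ 2) * y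
        + 8 * (1 - α ^ 2 * x ^ 2 - y ^ 2) * y - 8 * y ^ 3) / 24) * t
      + (-a / 2 + b * (-10 * (1 - α ^ 2 * x ^ 2 - y ^ 2) + 20 * y ^ 2
        + 4 * (1 - α ^ 2 * x ^ 2 - y ^ 2) - 20 * y ^ 2) / 24) * t ^ 2
      + (b * (20 * y - 16 * y) / 24) * t ^ 3 + (b * (5 - 4) / 24) * t ^ 4 := by
    funext t
    simp [axisLine, barrier, ellipseFun, ← hx, ← hy]
    ring
  rw [e0, e1, deriv_deriv_poly, deriv_deriv_poly]
  simp only [ellipseFun, ← hx, ← hy]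
  ring

lemma integral_gaussian_R2 : ∫ y : R2, rexp (-‖y‖ ^ 2) = π := by
  have := GaussianFourier.integral_rexp_neg_mul_sq_norm (V := R2) one_pos
  simpa using this

lemma integrable_gaussian_R2 {b : ℝ} (hb : 0 < b) :
    Integrable (fun y : R2 => rexp (-b * ‖y‖ ^ 2)) := by
  refine Integrable.of_integral_ne_zero ?_
  rw [GaussianFourier.integral_rexp_neg_mul_sq_norm hb]
  positivity

lemma integrable_gaussian_one : Integrable (fun y : R2 => rexp (-‖y‖ ^ 2)) := by
  simpa using integrable_gaussian_R2 one_pos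

lemma integrable_norm_mul_gaussian : Integrable (fun y : R2 => ‖y‖ * rexp (-‖y‖ ^ 2)) := by
  refine (integrable_gaussian_R2 (b := 1 / 2) (by norm_num)).mono'
    (by fun_prop) (Eventually.of_forall fun y => ?_)
  rw [Real.norm_of_nonneg (by positivity)]
  have h1 : ‖y‖ ≤ rexp (‖y‖ ^ 2 / 2) := by
    nlinarith [Real.add_one_le_exp (‖y‖ ^ 2 / 2), sq_nonneg (‖y‖ - 1)]
  calc ‖y‖ * rexp (-‖y‖ ^ 2) ≤ rexp (‖y‖ ^ 2 / 2) * rexp (-‖y‖ ^ 2) := by gcongr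
    _ = rexp (-(1 / 2) * ‖y‖ ^ 2) := by rw [← Real.exp_add]; ring_nf

lemma integrable_bounded_mul_gaussian {f : R2 → ℝ} (hf : Continuous f) {K : ℝ}
    (hK : ∀ y, ‖f y‖ ≤ K) : Integrable (fun y => f y * rexp (-‖y‖ ^ 2)) :=
  integrable_gaussian_one.bdd_mul hf.aestronglyMeasurable (Eventually.of_forall hK)

lemma hasFDerivAt_gaussian (y : R2) :
    HasFDerivAt (fun y : R2 => rexp (-‖y‖ ^ 2))
      (rexp (-‖y‖ ^ 2) • -((2 : ℕ) • (innerSL ℝ y : R2 →L[ℝ] ℝ))) y :=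
  ((hasStrictFDerivAt_norm_sq y).hasFDerivAt.neg).exp

lemma lap_eq_sum_fderiv {w : R2 → ℝ} (hw : ContDiff ℝ 2 w) (p : R2) :
    lap w p = ∑ i : Fin 2, fderiv ℝ (fun q => fderiv ℝ w q (EuclideanSpace.single i 1)) p
      (EuclideanSpace.single i 1) := by
  rw [lap_eq_sum_deriv]
  refine Finset.sum_congr rfl fun i _ => ?_
  set e : R2 := EuclideanSpace.single i 1
  have hline : ∀ t : ℝ, HasDerivAt (fun t : ℝ => p + t • e) e t := fun t => by
    simpa using ((hasDerivAt_id t).smul_const e).const_add p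
  have h1 : deriv (axisLine w p i) = fun t => fderiv ℝ w (p + t • e) e := by
    funext t
    exact ((hw.differentiable (by norm_num) _).hasFDerivAt.comp_hasDerivAt t (hline t)).deriv
  have h2 : Differentiable ℝ (fun q => fderiv ℝ w q e) :=
    ((hw.fderiv_right (m := 1) (by norm_num)).clm_apply contDiff_const).differentiable
      (by norm_num)
  rw [h1]
  have := ((h2 (p + (0 : ℝ) • e)).hasFDerivAt.comp_hasDerivAt (0 : ℝ) (hline 0)).deriv
  simpa [Function.comp_def] using this

lemma fderiv_apply_eq_sum (w : R2 → ℝ) (q y : R2) :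
    fderiv ℝ w q y = ∑ i : Fin 2, fderiv ℝ w q (EuclideanSpace.single i 1) * y i := by
  have : y = ∑ i : Fin 2, y i • (EuclideanSpace.single i 1 : R2) := by
    ext j; fin_cases j <;> simp
  conv_lhs => rw [this]
  simp only [map_sum, map_smul, smul_eq_mul]
  exact Finset.sum_congr rfl fun i _ => mul_comm _ _

/-- The Stein identity for the Gaussian weight along a coordinate axis. -/
lemma integral_mul_coord_gaussian {f : R2 → ℝ} (hf : ContDiff ℝ 1 f) (hs : HasCompactSupport f)
    (x : R2) (s : ℝ) (i : Fin 2) :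
    Integrable (fun y => f (x + s • y) * y i * rexp (-‖y‖ ^ 2)) ∧
    ∫ y, f (x + s • y) * y i * rexp (-‖y‖ ^ 2) =
      s / 2 * ∫ y, fderiv ℝ f (x + s • y) (EuclideanSpace.single i 1) * rexp (-‖y‖ ^ 2) := by
  set e : R2 := EuclideanSpace.single i 1 with he
  obtain ⟨K, hK⟩ := hf.continuous.bounded_above_of_compact_support hs
  have hDc : Continuous fun q => fderiv ℝ f q e :=
    (hf.continuous_fderiv (by norm_num)).clm_apply continuous_const
  have hDs : HasCompactSupport fun q => fderiv ℝ f q e := hs.fderiv_apply ℝ e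
  obtain ⟨K', hK'⟩ := hDc.bounded_above_of_compact_support hDs
  have haff : Continuous fun y : R2 => x + s • y := by fun_prop
  have hcomp : ∀ y, HasFDerivAt (fun y => f (x + s • y))
      ((fderiv ℝ f (x + s • y)).comp (s • ContinuousLinearMap.id ℝ R2)) y := fun y =>
    (hf.differentiable (by norm_num) _).hasFDerivAt.comp y
      (((hasFDerivAt_id y).const_smul s).const_add x)
  have hI : Integrable (fun y => f (x + s • y) * y i * rexp (-‖y‖ ^ 2)) := by
    refine (integrable_norm_mul_gaussian.const_mul K).mono' ?_ (Eventually.of_forall fun y => ?_)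
    · have := hf.continuous
      exact Continuous.aestronglyMeasurable (by fun_prop)
    · rw [norm_mul, norm_mul, Real.norm_of_nonneg (Real.exp_pos _).le, mul_assoc]
      have h0 : (0 : ℝ) ≤ K := (norm_nonneg _).trans (hK x)
      have h1 : ‖y i‖ ≤ ‖y‖ := PiLp.norm_apply_le y i
      gcongr
      exact hK _
  refine ⟨hI, ?_⟩
  have hG : ∀ y : R2, fderiv ℝ (fun y : R2 => rexp (-‖y‖ ^ 2)) y e =
      -2 * (y i * rexp (-‖y‖ ^ 2)) := fun y => by
    rw [(hasFDerivAt_gaussian y).fderiv]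
    simp [he, EuclideanSpace.inner_single_right]
    ring
  have hF : ∀ y : R2, fderiv ℝ (fun y => f (x + s • y)) y e = s * fderiv ℝ f (x + s • y) e :=
    fun y => by rw [(hcomp y).fderiv]; simp
  have key := integral_mul_fderiv_eq_neg_fderiv_mul_of_integrable (μ := (volume : Measure R2))
    (f := fun y => f (x + s • y)) (g := fun y : R2 => rexp (-‖y‖ ^ 2)) (v := e) ?_ ?_ ?_
    (fun y _ => (hcomp y).differentiableAt) (fun y _ => (hasFDerivAt_gaussian y).differentiableAt)
  · simp only [hG, hF] at key
    have e1 : ∀ y : R2, f (x + s • y) * (-2 * (y i * rexp (-‖y‖ ^ 2))) =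
        -2 * (f (x + s • y) * y i * rexp (-‖y‖ ^ 2)) := fun y => by ring
    simp only [e1, mul_assoc s, integral_const_mul] at key
    linarith
  · simp only [hF, mul_assoc]
    exact (integrable_bounded_mul_gaussian (hDc.comp haff) fun y => hK' _).const_mul s
  · simp only [hG]
    refine (hI.const_mul (-2)).congr (Eventually.of_forall fun y => ?_)
    ring
  · exact integrable_bounded_mul_gaussian (hf.continuous.comp haff) fun y => hK _

lemma hasDerivAt_gaussian_average {w : R2 → ℝ} (hw : ContDiff ℝ 2 w) (hs : HasCompactSupport w)
    (x : R2) (s : ℝ) :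
    HasDerivAt (fun s : ℝ => ∫ y, w (x + s • y) * rexp (-‖y‖ ^ 2))
      (s / 2 * ∫ y, lap w (x + s • y) * rexp (-‖y‖ ^ 2)) s := by
  have hfc : Continuous (fderiv ℝ w) := hw.continuous_fderiv (by norm_num)
  obtain ⟨K₀, hK₀⟩ := hw.continuous.bounded_above_of_compact_support hs
  obtain ⟨K, hK⟩ := hfc.bounded_above_of_compact_support (hs.fderiv ℝ)
  have hwc := hw.continuous
  have h := (hasDerivAt_integral_of_dominated_loc_of_deriv_le (μ := (volume : Measure R2))
    (F := fun (s : ℝ) (y : R2) => w (x + s • y) * rexp (-‖y‖ ^ 2))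
    (F' := fun (s : ℝ) (y : R2) => fderiv ℝ w (x + s • y) y * rexp (-‖y‖ ^ 2))
    (x₀ := s) (s := Set.univ) (bound := fun y => K * (‖y‖ * rexp (-‖y‖ ^ 2))) univ_mem
    (Eventually.of_forall fun s => Continuous.aestronglyMeasurable (by fun_prop))
    (integrable_bounded_mul_gaussian (by fun_prop) fun y => hK₀ _)
    (Continuous.aestronglyMeasurable (by fun_prop))
    (Eventually.of_forall fun y t _ => ?_) (integrable_norm_mul_gaussian.const_mul K)
    (Eventually.of_forall fun y t _ => ?_)).2
  · convert! h using 1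
    have hD : ∀ i : Fin 2, ContDiff ℝ 1 fun q => fderiv ℝ w q (EuclideanSpace.single i 1) :=
      fun i => (hw.fderiv_right (m := 1) (by norm_num)).clm_apply contDiff_const
    have hDs : ∀ i : Fin 2, HasCompactSupport
        fun q => fderiv ℝ w q (EuclideanSpace.single i 1) := fun i => hs.fderiv_apply ℝ _
    have hint : ∀ i : Fin 2, Integrable fun y => fderiv ℝ
        (fun q => fderiv ℝ w q (EuclideanSpace.single i 1)) (x + s • y)
          (EuclideanSpace.single i 1) * rexp (-‖y‖ ^ 2) := fun i => by
      have hc : Continuous fun q => fderiv ℝ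
          (fun q => fderiv ℝ w q (EuclideanSpace.single i 1)) q (EuclideanSpace.single i 1) :=
        ((hD i).continuous_fderiv (by norm_num)).clm_apply continuous_const
      obtain ⟨K', hK'⟩ := hc.bounded_above_of_compact_support ((hDs i).fderiv_apply ℝ _)
      exact integrable_bounded_mul_gaussian
        (hc.comp (by fun_prop : Continuous fun y : R2 => x + s • y)) fun y => hK' _
    have hsum : ∀ y, fderiv ℝ w (x + s • y) y * rexp (-‖y‖ ^ 2) = ∑ i : Fin 2,
        fderiv ℝ w (x + s • y) (EuclideanSpace.single i 1) * y i * rexp (-‖y‖ ^ 2) := fun y => by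
      rw [fderiv_apply_eq_sum, Finset.sum_mul]
    rw [integral_congr_ae (Eventually.of_forall hsum)]
    simp only [lap_eq_sum_fderiv hw, Finset.sum_mul]
    rw [integral_finsetSum _ fun i _ => hint i,
      integral_finsetSum _ fun i _ => (integral_mul_coord_gaussian (hD i) (hDs i) x s i).1,
      Finset.mul_sum]
    exact Finset.sum_congr rfl fun i _ =>
      (integral_mul_coord_gaussian (hD i) (hDs i) x s i).2.symm
  · rw [norm_mul, Real.norm_of_nonneg (Real.exp_pos _).le, ← mul_assoc]
    gcongr
    exact ContinuousLinearMap.le_of_opNorm_le _ (hK _) y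
  · have hline : HasDerivAt (fun t : ℝ => x + t • y) y t := by
      simpa using ((hasDerivAt_id t).smul_const y).const_add x
    exact ((hw.differentiable (by norm_num) _).hasFDerivAt.comp_hasDerivAt t hline).mul_const _

/-- Gaussian mean value inequality for functions whose Laplacian is bounded below. -/
lemma gaussian_mean_value {w : R2 → ℝ} (hw : ContDiff ℝ 2 w) (hs : HasCompactSupport w) {B : ℝ}
    (hB : ∀ p, -B ≤ lap w p) (x : R2) {r : ℝ} (hr : 0 < r) :
    π * w x ≤ π * B * r ^ 2 / 4 + ∫ y, w (x + r • y) * rexp (-‖y‖ ^ 2) := by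
  have hder := hasDerivAt_gaussian_average hw hs x
  have hder' : ∀ s : ℝ, HasDerivAt
      (fun s : ℝ => π * B * s ^ 2 / 4 + ∫ y, w (x + s • y) * rexp (-‖y‖ ^ 2))
      (π * B * s / 2 + s / 2 * ∫ y, lap w (x + s • y) * rexp (-‖y‖ ^ 2)) s := fun s => by
    have := (((hasDerivAt_pow 2 s).const_mul (π * B)).div_const 4).add (hder s)
    convert! this using 1
    norm_num
    ring
  have hmono : MonotoneOn
      (fun s : ℝ => π * B * s ^ 2 / 4 + ∫ y, w (x + s • y) * rexp (-‖y‖ ^ 2)) (Set.Ici 0) := by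
    refine monotoneOn_of_deriv_nonneg (convex_Ici 0)
      (fun s _ => (hder' s).continuousAt.continuousWithinAt)
      (fun s _ => (hder' s).differentiableAt.differentiableWithinAt) fun s hs' => ?_
    rw [interior_Ici] at hs'
    have hs0 : 0 < s := hs'
    rw [(hder' s).deriv]
    have hlapc : Continuous (lap w) := by
      rw [funext (lap_eq_sum_fderiv hw)]
      refine continuous_finsetSum _ fun i _ => ?_
      exact (((hw.fderiv_right (m := 1) (by norm_num)).clm_apply
        contDiff_const).continuous_fderiv (by norm_num)).clm_apply continuous_const
    have hlaps : HasCompactSupport (lap w) := by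
      rw [funext (lap_eq_sum_fderiv hw)]
      simp only [Fin.sum_univ_two]
      exact ((hs.fderiv_apply ℝ _).fderiv_apply ℝ _).add ((hs.fderiv_apply ℝ _).fderiv_apply ℝ _)
    obtain ⟨K, hK⟩ := hlapc.bounded_above_of_compact_support hlaps
    have hint : Integrable fun y => lap w (x + s • y) * rexp (-‖y‖ ^ 2) :=
      integrable_bounded_mul_gaussian (hlapc.comp (by fun_prop)) fun y => hK _
    have : -B * π ≤ ∫ y, lap w (x + s • y) * rexp (-‖y‖ ^ 2) := by
      rw [← integral_gaussian_R2, ← integral_const_mul]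
      refine integral_mono (integrable_gaussian_one.const_mul _) hint fun y => ?_
      exact mul_le_mul_of_nonneg_right (hB _) (Real.exp_pos _).le
    nlinarith
  have := hmono (Set.mem_Ici.2 le_rfl) (Set.mem_Ici.2 hr.le) hr.le
  simp only [zero_smul, add_zero, integral_const_mul, integral_gaussian_R2] at this
  linarith

lemma hasDerivAt_max_sub_one_pow (n : ℕ) (t : ℝ) :
    HasDerivAt (fun t : ℝ => max (t - 1) 0 ^ (n + 2)) ((n + 2) * max (t - 1) 0 ^ (n + 1)) t := by
  have hzero : ∀ x : ℝ, x ≤ 1 → max (x - 1) 0 ^ (n + 2) = 0 := fun x hx => by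
    rw [max_eq_right (by linarith)]; simp
  have hpow : ∀ x : ℝ, 1 ≤ x → max (x - 1) 0 ^ (n + 2) = (x - 1) ^ (n + 2) := fun x hx => by
    rw [max_eq_left (by linarith)]
  have hder : ∀ x : ℝ, HasDerivAt (fun x : ℝ => (x - 1) ^ (n + 2))
      ((n + 2) * (x - 1) ^ (n + 1)) x := fun x => by
    have := ((hasDerivAt_id x).sub_const 1).pow (n + 2)
    convert! this using 1
    simp
  rcases lt_trichotomy t 1 with ht | rfl | ht
  · rw [max_eq_right (by linarith : t - 1 ≤ 0)]
    have : HasDerivAt (fun _ : ℝ => (0 : ℝ)) ((n + 2) * (0 : ℝ) ^ (n + 1)) t := by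
      simpa using hasDerivAt_const t (0 : ℝ)
    exact this.congr_of_eventuallyEq
      ((eventually_lt_nhds ht).mono fun x hx => hzero x (le_of_lt hx))
  · have h1 : HasDerivWithinAt (fun t : ℝ => max (t - 1) 0 ^ (n + 2)) 0 (Set.Iic 1) 1 :=
      (hasDerivWithinAt_const (1 : ℝ) _ (0 : ℝ)).congr (fun x hx => hzero x hx) (hzero 1 le_rfl)
    have h2 : HasDerivWithinAt (fun t : ℝ => max (t - 1) 0 ^ (n + 2)) 0 (Set.Ici 1) 1 := by
      have := (hder 1).hasDerivWithinAt (s := Set.Ici 1)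
      simp only [sub_self, zero_pow n.succ_ne_zero, mul_zero] at this
      exact this.congr (fun x hx => hpow x hx) (hpow 1 le_rfl)
    have := h1.union h2
    rw [Set.Iic_union_Ici, hasDerivWithinAt_univ] at this
    simpa using this
  · rw [max_eq_left (by linarith : 0 ≤ t - 1)]
    exact (hder t).congr_of_eventuallyEq
      ((eventually_gt_nhds ht).mono fun x hx => hpow x (le_of_lt hx))

/-- A convex nondecreasing `C²` function vanishing on `(-∞, 1]`. -/
def cubeExp (t : ℝ) : ℝ := max (t - 1) 0 ^ 3 * rexp t

/-- The derivative of `cubeExp`. -/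
def cubeExpDeriv (t : ℝ) : ℝ := (max (t - 1) 0 ^ 3 + 3 * max (t - 1) 0 ^ 2) * rexp t

/-- The second derivative of `cubeExp`. -/
def cubeExpDeriv₂ (t : ℝ) : ℝ :=
  (max (t - 1) 0 ^ 3 + 6 * max (t - 1) 0 ^ 2 + 6 * max (t - 1) 0) * rexp t

lemma hasDerivAt_cubeExp (t : ℝ) : HasDerivAt cubeExp (cubeExpDeriv t) t := by
  have := (hasDerivAt_max_sub_one_pow 1 t).mul (Real.hasDerivAt_exp t)
  convert! this using 1
  simp [cubeExpDeriv]
  ring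

lemma hasDerivAt_cubeExpDeriv (t : ℝ) : HasDerivAt cubeExpDeriv (cubeExpDeriv₂ t) t := by
  have := ((hasDerivAt_max_sub_one_pow 1 t).add
    ((hasDerivAt_max_sub_one_pow 0 t).const_mul 3)).mul (Real.hasDerivAt_exp t)
  convert! this using 1
  simp [cubeExpDeriv₂]
  ring

lemma contDiff_cubeExp : ContDiff ℝ 2 cubeExp := by
  have hd1 : deriv cubeExp = cubeExpDeriv := funext fun t => (hasDerivAt_cubeExp t).deriv
  have hd2 : deriv cubeExpDeriv = cubeExpDeriv₂ := funext fun t => (hasDerivAt_cubeExpDeriv t).deriv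
  rw [show (2 : WithTop ℕ∞) = 1 + 1 by norm_num, contDiff_succ_iff_deriv]
  refine ⟨fun t => (hasDerivAt_cubeExp t).differentiableAt, by simp, ?_⟩
  rw [hd1, contDiff_one_iff_deriv, hd2]
  refine ⟨fun t => (hasDerivAt_cubeExpDeriv t).differentiableAt, ?_⟩
  unfold cubeExpDeriv₂
  fun_prop

lemma cubeExpDeriv_nonneg (t : ℝ) : 0 ≤ cubeExpDeriv t := by
  have : 0 ≤ max (t - 1) 0 := le_max_right _ _
  unfold cubeExpDeriv; positivity

lemma cubeExpDeriv₂_nonneg (t : ℝ) : 0 ≤ cubeExpDeriv₂ t := by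
  have : 0 ≤ max (t - 1) 0 := le_max_right _ _
  unfold cubeExpDeriv₂; positivity

lemma cubeExpDeriv_mono : Monotone cubeExpDeriv :=
  monotone_of_deriv_nonneg (fun t => (hasDerivAt_cubeExpDeriv t).differentiableAt) fun t => by
    rw [(hasDerivAt_cubeExpDeriv t).deriv]; exact cubeExpDeriv₂_nonneg t

lemma cubeExp_eq_zero {t : ℝ} (ht : t ≤ 1) : cubeExp t = 0 := by
  simp [cubeExp, max_eq_right (by linarith : t - 1 ≤ 0)]

lemma lap_congr {u v : R2 → ℝ} {p : R2} (h : u =ᶠ[𝓝 p] v) : lap u p = lap v p := by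
  simp only [lap_eq_sum_deriv]
  refine Finset.sum_congr rfl fun i _ => ?_
  have : axisLine u p i =ᶠ[𝓝 0] axisLine v p i := (tendsto_axis p i).eventually h
  exact this.deriv.deriv_eq

lemma lap_cubeExp_comp_ge {u : R2 → ℝ} {p : R2} (hu : ContDiffAt ℝ 2 u p) :
    cubeExpDeriv (u p) * lap u p ≤ lap (fun q => cubeExp (u q)) p := by
  simp only [lap_eq_sum_deriv, Finset.mul_sum]
  refine Finset.sum_le_sum fun i _ => ?_
  have hv := contDiffAt_axisLine hu i
  set v := axisLine u p i with hvdef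
  have hv0 : v 0 = u p := by simp [hvdef, axisLine]
  have hev : ∀ᶠ t in 𝓝 (0 : ℝ), DifferentiableAt ℝ v t := by
    filter_upwards [hv.eventually (by simp)] with t ht using ht.differentiableAt (by norm_num)
  have hd1 : deriv (axisLine (fun q => cubeExp (u q)) p i) =ᶠ[𝓝 0]
      fun t => cubeExpDeriv (v t) * deriv v t := by
    filter_upwards [hev] with t ht
    exact ((hasDerivAt_cubeExp (v t)).comp t ht.hasDerivAt).deriv
  have hdv : DifferentiableAt ℝ (deriv v) 0 := by
    exact (hv.derivWithin (m := 1) (by norm_num)).differentiableAt (by norm_num)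
  rw [hd1.deriv_eq]
  have h2 : HasDerivAt (fun t => cubeExpDeriv (v t) * deriv v t)
      (cubeExpDeriv₂ (v 0) * deriv v 0 * deriv v 0 + cubeExpDeriv (v 0) * deriv (deriv v) 0) 0 :=
    ((hasDerivAt_cubeExpDeriv (v 0)).comp (0 : ℝ) hev.self_of_nhds.hasDerivAt).mul hdv.hasDerivAt
  rw [h2.deriv, hv0]
  have := mul_nonneg (cubeExpDeriv₂_nonneg (u p)) (mul_self_nonneg (deriv v 0))
  linarith

/-- A priori bound on the maximum of a solution of `-Δu = μ eᵘ` in terms of `μ ∫ u eᵘ`. -/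
lemma max_le_of_integral_le {Ω : Set R2} (ho : IsOpen Ω) (hb : Bornology.IsBounded Ω)
    {u : R2 → ℝ} {μ A M : ℝ} (hμ : 0 < μ) (hu : ContDiffOn ℝ 2 u Ω)
    (huc : ContinuousOn u (closure Ω)) (hbd : ∀ p ∈ frontier Ω, u p = 0)
    (heq : ∀ p ∈ Ω, lap u p = -(μ * rexp (u p))) (hnn : ∀ p ∈ Ω, 0 ≤ u p)
    (hM : ∀ p ∈ Ω, u p ≤ M) {x : R2} (hx : x ∈ Ω) (hxM : u x = M)
    (hA : μ * ∫ p in Ω, u p * rexp (u p) ≤ A) (hA0 : 0 ≤ A) : M ≤ 2 + A := by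
  rcases le_or_gt M 1 with hM1 | hM1
  · linarith
  set w : R2 → ℝ := Ω.indicator fun q => cubeExp (u q) with hw
  set K : Set R2 := closure Ω ∩ u ⁻¹' Set.Ici 1 with hK
  have hKc : IsClosed K := huc.preimage_isClosed_of_isClosed isClosed_closure isClosed_Ici
  have hKcomp : IsCompact K := hb.isCompact_closure.of_isClosed_subset hKc inter_subset_left
  have hKΩ : K ⊆ Ω := fun p hp => by
    by_contra hpΩ
    have : u p = 0 := hbd p (by rw [ho.frontier_eq]; exact ⟨hp.1, hpΩ⟩)
    have h1 : (1 : ℝ) ≤ u p := hp.2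
    linarith
  have hwK : ∀ p, p ∉ K → w p = 0 := fun p hp => by
    by_cases hpΩ : p ∈ Ω
    · rw [hw, Set.indicator_of_mem hpΩ]
      refine cubeExp_eq_zero (not_lt.1 fun h => hp ⟨subset_closure hpΩ, ?_⟩)
      exact h.le
    · rw [hw, Set.indicator_of_notMem hpΩ]
  have hwΩ : ∀ p ∈ Ω, w =ᶠ[𝓝 p] fun q => cubeExp (u q) := fun p hp => by
    filter_upwards [ho.mem_nhds hp] with q hq using Set.indicator_of_mem hq _
  have hwout : ∀ p, p ∉ Ω → w =ᶠ[𝓝 p] fun _ => 0 := fun p hp => by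
    filter_upwards [hKc.isOpen_compl.mem_nhds fun h => hp (hKΩ h)] with q hq using hwK q hq
  have hwsupp : HasCompactSupport w := HasCompactSupport.intro hKcomp hwK
  have hwC : ContDiff ℝ 2 w := contDiff_iff_contDiffAt.2 fun p => by
    by_cases hp : p ∈ Ω
    · exact (contDiff_cubeExp.contDiffAt.comp p (hu.contDiffAt (ho.mem_nhds hp))).congr_of_eventuallyEq
        (hwΩ p hp)
    · exact contDiffAt_const.congr_of_eventuallyEq (hwout p hp)
  have hwnn : ∀ p, 0 ≤ w p := fun p => by
    refine Set.indicator_nonneg (fun q _ => ?_) p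
    have : 0 ≤ max (u q - 1) 0 := le_max_right _ _
    unfold cubeExp; positivity
  have hlap : ∀ p, -(cubeExpDeriv M * (μ * rexp M)) ≤ lap w p := fun p => by
    by_cases hp : p ∈ Ω
    · rw [lap_congr (hwΩ p hp)]
      refine le_trans ?_ (lap_cubeExp_comp_ge (hu.contDiffAt (ho.mem_nhds hp)))
      rw [heq p hp, mul_neg, neg_le_neg_iff]
      have h1 := cubeExpDeriv_mono (hM p hp)
      have h2 := Real.exp_le_exp.2 (hM p hp)
      have h3 := cubeExpDeriv_nonneg M
      gcongr
    · rw [lap_congr (hwout p hp)]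
      have h1 : lap (fun _ : R2 => (0 : ℝ)) p = 0 := by simp [lap]
      have h3 := cubeExpDeriv_nonneg M
      rw [h1, neg_nonpos]
      positivity
  set r : ℝ := 1 / √(μ * rexp M) with hr
  have hμM : 0 < μ * rexp M := by positivity
  have hr0 : 0 < r := by positivity
  have hr2 : r ^ 2 = 1 / (μ * rexp M) := by
    rw [hr, div_pow, Real.sq_sqrt hμM.le, one_pow]
  have hmv := gaussian_mean_value hwC hwsupp hlap x hr0
  have hwint : Integrable w := hwC.continuous.integrable_of_hasCompactSupport hwsupp
  have hm : 0 < M - 1 := by linarith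
  have hI1 : ∫ y, w (x + r • y) * rexp (-‖y‖ ^ 2) ≤ (μ * rexp M) * ∫ p, w p := by
    have hint : Integrable fun y => w (x + r • y) := by
      have : Integrable fun y => w (x + y) := hwint.comp_add_left x
      exact this.comp_smul hr0.ne'
    have h1 : ∫ y, w (x + r • y) * rexp (-‖y‖ ^ 2) ≤ ∫ y, w (x + r • y) := by
      refine integral_mono_of_nonneg (Eventually.of_forall fun y => ?_) hint
        (Eventually.of_forall fun y => ?_)
      · exact mul_nonneg (hwnn _) (Real.exp_pos _).le
      · refine mul_le_of_le_one_right (hwnn _) (Real.exp_le_one_iff.2 ?_)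
        simp
    have h2 : ∫ y, w (x + r • y) = (μ * rexp M) * ∫ p, w p := by
      rw [Measure.integral_comp_smul volume (fun y => w (x + y)) r,
        integral_add_left_eq_self w x]
      simp only [finrank_euclideanSpace, Fintype.card_fin, smul_eq_mul]
      rw [hr2, abs_of_pos (by positivity)]
      simp
    linarith
  have hI2 : ∫ p, w p ≤ (M - 1) ^ 2 * ∫ p in Ω, u p * rexp (u p) := by
    rw [hw, integral_indicator ho.measurableSet, ← integral_const_mul]
    have hcl : IntegrableOn (fun p => (M - 1) ^ 2 * (u p * rexp (u p))) Ω :=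
      (((huc.mul (Real.continuous_exp.comp_continuousOn huc)).const_mul _
        ).integrableOn_compact hb.isCompact_closure).mono_set subset_closure
    have hcl' : IntegrableOn (fun p => cubeExp (u p)) Ω :=
      ((contDiff_cubeExp.continuous.comp_continuousOn huc
        ).integrableOn_compact hb.isCompact_closure).mono_set subset_closure
    refine setIntegral_mono_on hcl' hcl ho.measurableSet fun p hp => ?_
    have h0 := hnn p hp
    have h1 := hM p hp
    rw [cubeExp, ← mul_assoc]
    refine mul_le_mul_of_nonneg_right ?_ (Real.exp_pos _).le
    have h2 : max (u p - 1) 0 ≤ M - 1 := max_le (by linarith) hm.le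
    have h3 : max (u p - 1) 0 ≤ u p := max_le (by linarith) h0
    have h4 : 0 ≤ max (u p - 1) 0 := le_max_right _ _
    calc max (u p - 1) 0 ^ 3 = max (u p - 1) 0 ^ 2 * max (u p - 1) 0 := by ring
      _ ≤ (M - 1) ^ 2 * u p := by gcongr
  have hwx : w x = (M - 1) ^ 3 * rexp M := by
    rw [hw, Set.indicator_of_mem hx, hxM, cubeExp, max_eq_left hm.le]
  have hgM : cubeExpDeriv M = ((M - 1) ^ 3 + 3 * (M - 1) ^ 2) * rexp M := by
    rw [cubeExpDeriv, max_eq_left hm.le]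
  have hBr : π * (cubeExpDeriv M * (μ * rexp M)) * r ^ 2 / 4 = π * cubeExpDeriv M / 4 := by
    rw [hr2]; field_simp
  rw [hBr, hwx, hgM] at hmv
  have hI3 : (μ * rexp M) * ∫ p, w p ≤ (M - 1) ^ 2 * rexp M * A := by
    calc (μ * rexp M) * ∫ p, w p
        ≤ (μ * rexp M) * ((M - 1) ^ 2 * ∫ p in Ω, u p * rexp (u p)) := by gcongr
      _ = (M - 1) ^ 2 * rexp M * (μ * ∫ p in Ω, u p * rexp (u p)) := by ring
      _ ≤ _ := by gcongr
  have hpos : 0 < (M - 1) ^ 2 * rexp M := by positivity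
  have hfin : (M - 1) ^ 2 * rexp M * (π * (M - 1)) ≤
      (M - 1) ^ 2 * rexp M * (π * ((M - 1) + 3) / 4 + A) := by
    nlinarith
  have hfin' := le_of_mul_le_mul_left hfin hpos
  nlinarith [Real.pi_gt_three]

lemma integral_unitDisc (a b c d : ℝ) :
    ∫ q : ℝ × ℝ, {q : ℝ × ℝ | q.1 ^ 2 + q.2 ^ 2 < 1}.indicator (fun q =>
      a + b * (1 - q.1 ^ 2 - q.2 ^ 2) + c * (1 - q.1 ^ 2 - q.2 ^ 2) ^ 2 +
        d * ((1 - q.1 ^ 2 - q.2 ^ 2) * q.2 ^ 2)) q =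
      π * (a + b / 2 + c / 3 + d / 12) := by
  set f : ℝ × ℝ → ℝ := {q : ℝ × ℝ | q.1 ^ 2 + q.2 ^ 2 < 1}.indicator (fun q =>
      a + b * (1 - q.1 ^ 2 - q.2 ^ 2) + c * (1 - q.1 ^ 2 - q.2 ^ 2) ^ 2 +
        d * ((1 - q.1 ^ 2 - q.2 ^ 2) * q.2 ^ 2)) with hf
  have hpt : ∀ p ∈ polarCoord.target, p.1 • f (polarCoord.symm p) =
      (Set.Ioo (0 : ℝ) 1 ×ˢ Set.Ioo (-π) π).indicator (fun p : ℝ × ℝ =>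
        p.1 * (a + b * (1 - p.1 ^ 2) + c * (1 - p.1 ^ 2) ^ 2) * 1 +
          p.1 * (d * ((1 - p.1 ^ 2) * p.1 ^ 2)) * Real.sin p.2 ^ 2) p := by
    rintro ⟨r, θ⟩ hp
    simp only [polarCoord_target, Set.mem_prod, Set.mem_Ioi] at hp
    have hsq : (r * Real.cos θ) ^ 2 + (r * Real.sin θ) ^ 2 = r ^ 2 := by
      linear_combination r ^ 2 * Real.sin_sq_add_cos_sq θ
    have hsq' : 1 - (r * Real.cos θ) ^ 2 - (r * Real.sin θ) ^ 2 = 1 - r ^ 2 := by linarith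
    by_cases hr : r < 1
    · have h1 : (r, θ) ∈ Set.Ioo (0 : ℝ) 1 ×ˢ Set.Ioo (-π) π := ⟨⟨hp.1, hr⟩, hp.2⟩
      have h2 : (r * Real.cos θ, r * Real.sin θ) ∈ {q : ℝ × ℝ | q.1 ^ 2 + q.2 ^ 2 < 1} := by
        change (r * Real.cos θ) ^ 2 + (r * Real.sin θ) ^ 2 < 1
        rw [hsq]; nlinarith [hp.1]
      rw [Set.indicator_of_mem h1, polarCoord_symm_apply, hf, Set.indicator_of_mem h2]
      simp only [hsq', smul_eq_mul]
      ring
    · have h1 : (r, θ) ∉ Set.Ioo (0 : ℝ) 1 ×ˢ Set.Ioo (-π) π := fun h => hr h.1.2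
      have h2 : (r * Real.cos θ, r * Real.sin θ) ∉ {q : ℝ × ℝ | q.1 ^ 2 + q.2 ^ 2 < 1} := by
        change ¬ (r * Real.cos θ) ^ 2 + (r * Real.sin θ) ^ 2 < 1
        rw [hsq]; nlinarith
      rw [Set.indicator_of_notMem h1, polarCoord_symm_apply, hf, Set.indicator_of_notMem h2,
        smul_zero]
  have hsub : Set.Ioo (0 : ℝ) 1 ×ˢ Set.Ioo (-π) π ⊆ polarCoord.target := by
    rw [polarCoord_target]
    exact Set.prod_mono (fun r hr => hr.1) subset_rfl
  have hmeas : MeasurableSet (Set.Ioo (0 : ℝ) 1 ×ˢ Set.Ioo (-π) π) :=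
    measurableSet_Ioo.prod measurableSet_Ioo
  rw [← integral_comp_polarCoord_symm f,
    setIntegral_congr_fun polarCoord.open_target.measurableSet hpt,
    setIntegral_indicator hmeas, Set.inter_eq_self_of_subset_right hsub]
  have hcompact : IsCompact (Set.Icc (0 : ℝ) 1 ×ˢ Set.Icc (-π) π) := isCompact_Icc.prod isCompact_Icc
  have hint : ∀ g : ℝ × ℝ → ℝ, Continuous g →
      IntegrableOn g (Set.Ioo (0 : ℝ) 1 ×ˢ Set.Ioo (-π) π) := fun g hg =>
    (hg.continuousOn.integrableOn_compact hcompact).mono_set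
      (Set.prod_mono Set.Ioo_subset_Icc_self Set.Ioo_subset_Icc_self)
  rw [integral_add (hint _ (by fun_prop)) (hint _ (by fun_prop)), Measure.volume_eq_prod,
    setIntegral_prod_mul (fun r : ℝ => r * (a + b * (1 - r ^ 2) + c * (1 - r ^ 2) ^ 2))
      (fun _ : ℝ => (1 : ℝ)),
    setIntegral_prod_mul (fun r : ℝ => r * (d * ((1 - r ^ 2) * r ^ 2)))
      (fun θ : ℝ => Real.sin θ ^ 2)]
  have hπ : -π ≤ π := by linarith [Real.pi_pos]
  simp only [← integral_Ioc_eq_integral_Ioo, ← intervalIntegral.integral_of_le zero_le_one,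
    ← intervalIntegral.integral_of_le hπ]
  have h1 : ∫ r in (0 : ℝ)..1, r * (a + b * (1 - r ^ 2) + c * (1 - r ^ 2) ^ 2) =
      a / 2 + b / 4 + c / 6 := by
    have hd : ∀ r ∈ Set.uIcc (0 : ℝ) 1, HasDerivAt
        (fun r : ℝ => a / 2 * r ^ 2 + b * (1 / 2 * r ^ 2 - 1 / 4 * r ^ 4)
          + c * (1 / 2 * r ^ 2 - 1 / 2 * r ^ 4 + 1 / 6 * r ^ 6))
        (r * (a + b * (1 - r ^ 2) + c * (1 - r ^ 2) ^ 2)) r := fun r _ => by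
      have p2 := hasDerivAt_pow 2 r
      have p4 := hasDerivAt_pow 4 r
      have p6 := hasDerivAt_pow 6 r
      have := ((p2.const_mul (a / 2)).add
        (((p2.const_mul (1 / 2)).sub (p4.const_mul (1 / 4))).const_mul b)).add
        ((((p2.const_mul (1 / 2)).sub (p4.const_mul (1 / 2))).add
          (p6.const_mul (1 / 6))).const_mul c)
      convert! this using 1
      norm_num
      ring
    rw [intervalIntegral.integral_eq_sub_of_hasDerivAt hd
      (Continuous.intervalIntegrable (by fun_prop) _ _)]
    ring
  have h2 : ∫ r in (0 : ℝ)..1, r * (d * ((1 - r ^ 2) * r ^ 2)) = d / 12 := by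
    have hd : ∀ r ∈ Set.uIcc (0 : ℝ) 1, HasDerivAt
        (fun r : ℝ => d * (1 / 4 * r ^ 4 - 1 / 6 * r ^ 6))
        (r * (d * ((1 - r ^ 2) * r ^ 2))) r := fun r _ => by
      have p4 := hasDerivAt_pow 4 r
      have p6 := hasDerivAt_pow 6 r
      have := ((p4.const_mul (1 / 4)).sub (p6.const_mul (1 / 6))).const_mul d
      convert! this using 1
      norm_num
      ring
    rw [intervalIntegral.integral_eq_sub_of_hasDerivAt hd
      (Continuous.intervalIntegrable (by fun_prop) _ _)]
    ring
  rw [h1, h2, integral_sin_sq]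
  simp
  ring

lemma integral_comp_mul_fst {α : ℝ} (hα : 0 < α) (f : ℝ × ℝ → ℝ) :
    ∫ q : ℝ × ℝ, f (α * q.1, q.2) = α⁻¹ * ∫ q, f q := by
  have hemb : MeasurableEmbedding (Prod.map (fun x : ℝ => α * x) (id : ℝ → ℝ)) :=
    ((Homeomorph.mulLeft₀ α hα.ne').prodCongr (Homeomorph.refl ℝ)).measurableEmbedding
  have hmap : Measure.map (Prod.map (fun x : ℝ => α * x) (id : ℝ → ℝ)) volume =
      ENNReal.ofReal |α⁻¹| • (volume : Measure (ℝ × ℝ)) := by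
    rw [Measure.volume_eq_prod, ← Measure.map_prod_map _ _ (by fun_prop) measurable_id,
      Measure.map_id, Real.map_volume_mul_left hα.ne', Measure.prod_smul_left]
  have := hemb.integral_map (μ := volume) f
  rw [hmap, integral_smul_measure, abs_of_pos (by positivity),
    ENNReal.toReal_ofReal (by positivity), smul_eq_mul] at this
  exact this.symm

lemma integral_ellipseO {α : ℝ} (hα : 0 < α) (a b c d : ℝ) :
    ∫ p in ellipseO α, (a + b * ellipseFun α p + c * ellipseFun α p ^ 2 +
      d * (ellipseFun α p * p 1 ^ 2)) = π / α * (a + b / 2 + c / 3 + d / 12) := by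
  rw [← integral_indicator (isOpen_ellipseO α).measurableSet]
  have h1 := (PiLp.volume_preserving_toLp (Fin 2)).integral_comp
    (MeasurableEquiv.toLp 2 (Fin 2 → ℝ)).measurableEmbedding ((ellipseO α).indicator fun p : R2 =>
      (a + b * ellipseFun α p + c * ellipseFun α p ^ 2 + d * (ellipseFun α p * p 1 ^ 2)))
  have h2 := (volume_preserving_finTwoArrow ℝ).symm.integral_comp
    (MeasurableEquiv.finTwoArrow (α := ℝ)).symm.measurableEmbedding
      (fun v : Fin 2 → ℝ => (ellipseO α).indicator (fun p : R2 =>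
      (a + b * ellipseFun α p + c * ellipseFun α p ^ 2 + d * (ellipseFun α p * p 1 ^ 2)))
        (WithLp.toLp 2 v))
  rw [← h1, ← h2]
  have h3 := integral_comp_mul_fst hα ({q : ℝ × ℝ | q.1 ^ 2 + q.2 ^ 2 < 1}.indicator (fun q =>
      a + b * (1 - q.1 ^ 2 - q.2 ^ 2) + c * (1 - q.1 ^ 2 - q.2 ^ 2) ^ 2 +
        d * ((1 - q.1 ^ 2 - q.2 ^ 2) * q.2 ^ 2)))
  rw [integral_unitDisc] at h3
  rw [show π / α * (a + b / 2 + c / 3 + d / 12) = α⁻¹ * (π * (a + b / 2 + c / 3 + d / 12)) by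
    field_simp, ← h3]
  refine integral_congr_ae (Eventually.of_forall fun q => ?_)
  simp [Set.indicator_apply, ellipseO, ellipseFun, mul_pow, MeasurableEquiv.finTwoArrow]

lemma lap_torsion (α a : ℝ) (p : R2) : lap (barrier α a 0) p = -(a * (1 + α ^ 2)) := by
  rw [lap_barrier]; ring

lemma barrier_torsion (α a : ℝ) (p : R2) : barrier α a 0 p = a * (ellipseFun α p / 2) := by
  simp [barrier]

lemma nonneg_of_lap_neg {Ω : Set R2} (ho : IsOpen Ω) (hb : Bornology.IsBounded Ω) {u : R2 → ℝ}
    (hu : ContDiffOn ℝ 2 u Ω) (huc : ContinuousOn u (closure Ω))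
    (hbd : ∀ p ∈ frontier Ω, u p = 0) (hlap : ∀ p ∈ Ω, lap u p < 0) :
    ∀ p ∈ closure Ω, 0 ≤ u p := by
  refine le_of_lap_lt ho hb contDiffOn_const hu continuousOn_const huc
    (fun p hp => (hbd p hp).ge) fun p hp => ?_
  have h : lap (fun _ : R2 => (0 : ℝ)) p = 0 := by simp [lap]
  rw [h]
  exact hlap p hp

lemma le_barrier {α a b : ℝ} (hα : 0 < α) {u : R2 → ℝ} (hu : ContDiffOn ℝ 2 u (ellipseO α))
    (huc : ContinuousOn u (closure (ellipseO α))) (hbd : ∀ p ∈ frontier (ellipseO α), u p = 0)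
    (hlap : ∀ p ∈ ellipseO α, lap (barrier α a b) p < lap u p) :
    ∀ p ∈ ellipseO α, u p ≤ barrier α a b p := fun p hp =>
  le_of_lap_lt (isOpen_ellipseO α) (isBounded_ellipseO hα) hu (contDiff_barrier α a b).contDiffOn
    huc (contDiff_barrier α a b).continuous.continuousOn
    (fun q hq => by rw [hbd q hq, barrier_eq_zero_of_mem_frontier hq]) hlap p (subset_closure hp)

lemma barrier_le {α a b : ℝ} (hα : 0 < α) {u : R2 → ℝ} (hu : ContDiffOn ℝ 2 u (ellipseO α))
    (huc : ContinuousOn u (closure (ellipseO α))) (hbd : ∀ p ∈ frontier (ellipseO α), u p = 0)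
    (hlap : ∀ p ∈ ellipseO α, lap u p < lap (barrier α a b) p) :
    ∀ p ∈ ellipseO α, barrier α a b p ≤ u p := fun p hp =>
  le_of_lap_lt (isOpen_ellipseO α) (isBounded_ellipseO hα) (contDiff_barrier α a b).contDiffOn hu
    (contDiff_barrier α a b).continuous.continuousOn huc
    (fun q hq => by rw [hbd q hq, barrier_eq_zero_of_mem_frontier hq]) hlap p (subset_closure hp)

lemma ellipse_coord_bounds {α : ℝ} {p : R2} (hp : p ∈ ellipseO α) :
    0 < ellipseFun α p ∧ ellipseFun α p ≤ 1 ∧ 0 ≤ α ^ 2 * p 0 ^ 2 ∧ α ^ 2 * p 0 ^ 2 ≤ 1 ∧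
      0 ≤ p 1 ^ 2 ∧ p 1 ^ 2 ≤ 1 := by
  have h0 := mem_ellipseO.1 hp
  have h1 : 0 ≤ α ^ 2 * p 0 ^ 2 := by positivity
  have h2 := sq_nonneg (p 1)
  refine ⟨h0, ?_, h1, ?_, h2, ?_⟩ <;> unfold ellipseFun at * <;> linarith

/-- Second order expansion of bounded solutions of `-Δu = μ eᵘ` on the ellipse `ω_α`. -/
lemma solution_expansion {α μ L c : ℝ} (hα : 0 < α) (hα1 : α ≤ 1) (hμ : 0 < μ) (hL : 1 ≤ L)
    (hμL : μ * L ≤ 1) (hμc : μ ≤ c * α) {u : R2 → ℝ} (hu : ContDiffOn ℝ 2 u (ellipseO α))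
    (huc : ContinuousOn u (closure (ellipseO α))) (hbd : ∀ p ∈ frontier (ellipseO α), u p = 0)
    (heq : ∀ p ∈ ellipseO α, lap u p = -(μ * rexp (u p)))
    (hnn : ∀ p ∈ ellipseO α, 0 ≤ u p) (hub : ∀ p ∈ ellipseO α, rexp (u p) ≤ L) :
    ∀ p ∈ ellipseO α, u p ≤ μ * L ∧
      |u p - barrier α μ (μ ^ 2) p| ≤ (2 * L ^ 2 * c ^ 2 + 4) * μ * α ^ 2 := by
  have hα2 : 0 < α ^ 2 := by positivity
  have hα2' : α ^ 2 ≤ 1 := pow_le_one₀ hα.le hα1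
  have hμ1 : μ ≤ 1 := by nlinarith
  have hμ2 : μ ^ 2 ≤ c ^ 2 * α ^ 2 := by
    rw [← mul_pow]; exact pow_le_pow_left₀ hμ.le hμc 2
  have hLpos : 0 < L := by linarith
  have hμLpos : 0 < μ * L := by positivity
  have up1 : ∀ p ∈ ellipseO α, u p ≤ μ * L * (ellipseFun α p / 2) := fun p hp => by
    rw [← barrier_torsion]
    refine le_barrier hα hu huc hbd (fun q hq => ?_) p hp
    rw [lap_torsion, heq q hq, neg_lt_neg_iff]
    have := mul_le_mul_of_nonneg_left (hub q hq) hμ.le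
    nlinarith
  have up1' : ∀ p ∈ ellipseO α, u p ≤ μ * L / 2 := fun p hp => by
    obtain ⟨h0, h1, -⟩ := ellipse_coord_bounds hp
    nlinarith [up1 p hp]
  have hexp : ∀ p ∈ ellipseO α, rexp (u p) ≤ 1 + u p + u p ^ 2 := fun p hp => by
    have h0 := hnn p hp
    have h1 : u p ≤ 1 := by linarith [up1' p hp]
    have := Real.abs_exp_sub_one_sub_id_le (x := u p) (by rw [abs_of_nonneg h0]; exact h1)
    linarith [(abs_le.1 this).2]
  have up2 : ∀ p ∈ ellipseO α, u p ≤ μ * (1 + μ * L) * (ellipseFun α p / 2) := fun p hp => by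
    rw [← barrier_torsion]
    refine le_barrier hα hu huc hbd (fun q hq => ?_) p hp
    rw [lap_torsion, heq q hq, neg_lt_neg_iff]
    have h0 := hnn q hq
    have h1 := up1' q hq
    have h2 : rexp (u q) ≤ 1 + μ * L := by nlinarith [hexp q hq]
    have h3 := mul_le_mul_of_nonneg_left h2 hμ.le
    have h4 : 0 < μ * (1 + μ * L) * α ^ 2 := by positivity
    linarith
  have low1 : ∀ p ∈ ellipseO α, μ * (1 - α ^ 2) * (ellipseFun α p / 2) ≤ u p := fun p hp => by
    rw [← barrier_torsion]
    refine barrier_le hα hu huc hbd (fun q hq => ?_) p hp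
    rw [lap_torsion, heq q hq, neg_lt_neg_iff]
    have h1 : 1 ≤ rexp (u q) := Real.one_le_exp (hnn q hq)
    have h3 := mul_le_mul_of_nonneg_left h1 hμ.le
    have h4 : 0 < μ * (α ^ 2 * α ^ 2) := by positivity
    linarith
  set K : ℝ := 2 * L ^ 2 * c ^ 2 + 4 with hK
  have hc2 : 0 ≤ L ^ 2 * c ^ 2 := by positivity
  have hKpos : 4 ≤ K := by linarith
  have hμα : 0 < μ * α ^ 2 := by positivity
  have hμα1 : μ * (μ * α ^ 2) ≤ μ * α ^ 2 := by nlinarith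
  have up3 : ∀ p ∈ ellipseO α, u p ≤ barrier α (μ * (1 + K * α ^ 2)) (μ ^ 2) p := by
    refine le_barrier hα hu huc hbd fun q hq => ?_
    rw [lap_barrier, heq q hq]
    obtain ⟨h0, h1, h2, h3, h4, h5⟩ := ellipse_coord_bounds hq
    have hLL : L ≤ L ^ 2 := by nlinarith
    have hu2 : u q ≤ μ * (ellipseFun α q / 2) + μ ^ 2 * L / 2 := by
      have := up2 q hq
      have h6 : μ ^ 2 * L * ellipseFun α q ≤ μ ^ 2 * L * 1 := by gcongr
      nlinarith
    have hsq : u q ^ 2 ≤ μ ^ 2 * L ^ 2 := by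
      rw [← mul_pow]
      exact pow_le_pow_left₀ (hnn q hq) (by linarith [up1' q hq]) 2
    have hm2L : μ ^ 2 * L ≤ μ ^ 2 * L ^ 2 := by gcongr
    have hm2L2 : μ ^ 2 * L ^ 2 ≤ c ^ 2 * α ^ 2 * L ^ 2 := by gcongr
    have he : rexp (u q) ≤ 1 + μ * (ellipseFun α q / 2) + 2 * (c ^ 2 * α ^ 2 * L ^ 2) := by
      have h7 : 0 ≤ c ^ 2 * α ^ 2 * L ^ 2 := by positivity
      linarith [hexp q hq]
    have he' := mul_le_mul_of_nonneg_left he hμ.le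
    have hbr : μ * (μ * α ^ 2) * (40 * (α ^ 2 * q 0 ^ 2) - 20 * ellipseFun α q - 8 * q 1 ^ 2) ≤
        μ * (μ * α ^ 2) * 40 := by
      gcongr
      linarith
    have h8 : 0 ≤ μ * K * α ^ 2 * α ^ 2 := by positivity
    rw [hK] at *
    nlinarith
  have low3 : ∀ p ∈ ellipseO α, barrier α (μ * (1 - K * α ^ 2)) (μ ^ 2) p ≤ u p := by
    refine barrier_le hα hu huc hbd fun q hq => ?_
    rw [lap_barrier, heq q hq]
    obtain ⟨h0, h1, h2, h3, h4, h5⟩ := ellipse_coord_bounds hq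
    have hu2 : μ * (ellipseFun α q / 2) - μ * α ^ 2 / 2 ≤ u q := by
      have := low1 q hq
      have h6 : μ * α ^ 2 * ellipseFun α q ≤ μ * α ^ 2 * 1 := by gcongr
      linarith
    have he : 1 + (μ * (ellipseFun α q / 2) - μ * α ^ 2 / 2) ≤ rexp (u q) := by
      linarith [Real.add_one_le_exp (u q)]
    have he' := mul_le_mul_of_nonneg_left he hμ.le
    have hbr : μ * (μ * α ^ 2) * (-28) ≤ μ * (μ * α ^ 2) *
        (40 * (α ^ 2 * q 0 ^ 2) - 20 * ellipseFun α q - 8 * q 1 ^ 2) := by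
      gcongr
      linarith
    have h8 : 0 ≤ μ * K * α ^ 2 * α ^ 2 := by positivity
    have h9 : μ * α ^ 2 * 4 ≤ μ * α ^ 2 * K := by gcongr
    nlinarith
  intro p hp
  obtain ⟨h0, h1, -⟩ := ellipse_coord_bounds hp
  have h2 : μ * K * α ^ 2 * ellipseFun α p ≤ μ * K * α ^ 2 * 1 := by gcongr
  have h3 : 0 ≤ μ * K * α ^ 2 := by positivity
  refine ⟨by linarith [up1' p hp], abs_le.2 ⟨?_, ?_⟩⟩
  · have := low3 p hp
    unfold barrier at *
    linarith
  · have := up3 p hp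
    unfold barrier at *
    linarith

lemma abs_exp_sub_le {α μ L c K s u v : ℝ} (hμ : 0 < μ) (hμ1 : μ ≤ 1)
    (hμc : μ ^ 2 ≤ c ^ 2 * α ^ 2) (hK : 0 ≤ K) (hL : 1 ≤ L) (hs0 : 0 ≤ s) (hs1 : s ≤ 1)
    (hv0 : 0 ≤ v) (hv1 : v ≤ 1) (hu0 : 0 ≤ u) (huL : u ≤ μ * L) (hμL : μ * L ≤ 1)
    (hu : |u - (μ * (s / 2) + μ ^ 2 * v)| ≤ K * μ * α ^ 2) :
    |rexp u - (1 + μ / 2 * s)| ≤ (c ^ 2 * L ^ 2 + c ^ 2 + K) * α ^ 2 ∧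
    |u * rexp u - (μ / 2 * s + μ ^ 2 * v + μ ^ 2 / 4 * s ^ 2)| ≤
      (c ^ 2 * L ^ 3 + K + 2 * L * (c ^ 2 + K)) * μ * α ^ 2 := by
  have hα0 : 0 ≤ α ^ 2 := sq_nonneg α
  have hexp := Real.abs_exp_sub_one_sub_id_le (x := u) (by rw [abs_of_nonneg hu0]; linarith)
  have husq : u ^ 2 ≤ c ^ 2 * L ^ 2 * α ^ 2 := by
    calc u ^ 2 ≤ (μ * L) ^ 2 := pow_le_pow_left₀ hu0 huL 2
      _ = μ ^ 2 * L ^ 2 := by ring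
      _ ≤ c ^ 2 * α ^ 2 * L ^ 2 := by gcongr
      _ = _ := by ring
  have hv : μ ^ 2 * v ≤ c ^ 2 * α ^ 2 := by nlinarith [sq_nonneg μ]
  have hv' : 0 ≤ μ ^ 2 * v := by positivity
  have hKα : K * μ * α ^ 2 ≤ K * α ^ 2 := by
    have : 0 ≤ K * α ^ 2 := by positivity
    nlinarith
  have hlin : |u - μ * (s / 2)| ≤ (c ^ 2 + K) * α ^ 2 := by
    rw [abs_le] at hu ⊢
    constructor <;> linarith [hu.1, hu.2]
  refine ⟨?_, ?_⟩
  · have e : rexp u - (1 + μ / 2 * s) = (rexp u - 1 - u) + (u - μ * (s / 2)) := by ring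
    rw [e]
    refine (abs_add_le _ _).trans ?_
    linarith
  · have e : u * rexp u - (μ / 2 * s + μ ^ 2 * v + μ ^ 2 / 4 * s ^ 2) =
        u * (rexp u - 1 - u) + (u - (μ * (s / 2) + μ ^ 2 * v)) +
          (u + μ * (s / 2)) * (u - μ * (s / 2)) := by ring
    have h1 : |u * (rexp u - 1 - u)| ≤ c ^ 2 * L ^ 3 * μ * α ^ 2 := by
      rw [abs_mul, abs_of_nonneg hu0]
      calc u * |rexp u - 1 - u| ≤ (μ * L) * (c ^ 2 * L ^ 2 * α ^ 2) := by
            gcongr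
            exact hexp.trans husq
        _ = _ := by ring
    have h2 : |(u + μ * (s / 2)) * (u - μ * (s / 2))| ≤ 2 * L * (c ^ 2 + K) * μ * α ^ 2 := by
      have h3 : 0 ≤ μ * (s / 2) := by positivity
      have h4 : μ * (s / 2) ≤ μ * L := by gcongr; linarith
      rw [abs_mul, abs_of_nonneg (by positivity)]
      calc (u + μ * (s / 2)) * |u - μ * (s / 2)| ≤ (μ * L + μ * L) * ((c ^ 2 + K) * α ^ 2) := by
            gcongr
        _ = _ := by ring
    rw [e]
    refine (abs_add_three _ _ _).trans ?_
    linarith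

lemma abs_setIntegral_sub_le {Ω : Set R2} (hb : Bornology.IsBounded Ω)
    {f g : R2 → ℝ} (hf : ContinuousOn f (closure Ω)) (hg : Continuous g) {k : ℝ}
    (h : ∀ p ∈ Ω, |f p - g p| ≤ k) :
    |(∫ p in Ω, f p) - ∫ p in Ω, g p| ≤ k * ∫ _ in Ω, (1 : ℝ) := by
  have hfi : IntegrableOn f Ω :=
    (hf.integrableOn_compact hb.isCompact_closure).mono_set subset_closure
  have hgi : IntegrableOn g Ω :=
    (hg.continuousOn.integrableOn_compact hb.isCompact_closure).mono_set subset_closure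
  rw [← integral_sub hfi hgi]
  have := norm_setIntegral_le_of_norm_le_const (μ := volume) (s := Ω) (f := fun p => f p - g p)
    (C := k) hb.measure_lt_top h
  simpa [mul_comm] using this

/-- Algebraic core of the expansion: `X` and `Y` are the averages of `eᵘ` and `u eᵘ`. -/
lemma energy_expansion_of_averages {α lam μ X Y C₁ C₂ c L : ℝ} (hα : 0 < α) (hα1 : α ≤ 1)
    (hlam : 0 < lam) (hμ : 0 < μ) (hμc : μ ≤ c * α) (hc : 0 ≤ c) (hX1 : 1 ≤ X)
    (hXL : X ≤ L) (hC₁ : 0 ≤ C₁) (hμX : μ * X = lam * α / π)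
    (hX : |X - (1 + μ / 4)| ≤ C₁ * α ^ 2)
    (hY : |Y - (μ / 4 + μ ^ 2 / 6)| ≤ C₂ * μ * α ^ 2) :
    |1 / (2 * lam) * (Y / X) - α / (8 * π) - α ^ 2 * lam / (48 * π ^ 2)| ≤
      (C₂ + C₁ + (c + C₁) ^ 2 + c * (c + C₁) * (3 + 3 * L + L ^ 2)) * α ^ 3 := by
  set C := C₂ + C₁ + (c + C₁) ^ 2 + c * (c + C₁) * (3 + 3 * L + L ^ 2) with hC
  have hXpos : 0 < X := by linarith
  obtain ⟨z, rfl⟩ : ∃ z, X = 1 + z := ⟨X - 1, by ring⟩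
  have hz0 : 0 ≤ z := by linarith
  have hzL : z ≤ L := by linarith
  have hzα : z ≤ (c + C₁) * α := by
    have h1 := (abs_le.1 hX).2
    have h2 : C₁ * α ^ 2 ≤ C₁ * α := by gcongr; nlinarith
    linarith
  have hz2 : z ^ 2 ≤ (c + C₁) ^ 2 * α ^ 2 := by
    rw [← mul_pow]; exact pow_le_pow_left₀ hz0 hzα 2
  have hrem : |Y - μ * (1 + z) ^ 2 / 4 - μ ^ 2 * (1 + z) ^ 3 / 24| ≤ C * μ * α ^ 2 := by
    have e : Y - μ * (1 + z) ^ 2 / 4 - μ ^ 2 * (1 + z) ^ 3 / 24 =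
        (Y - (μ / 4 + μ ^ 2 / 6)) - μ / 2 * ((1 + z) - (1 + μ / 4)) - μ / 4 * z ^ 2 -
          μ / 24 * (μ * z * (3 + 3 * z + z ^ 2)) := by ring
    have h1 : |μ / 2 * ((1 + z) - (1 + μ / 4))| ≤ μ / 2 * (C₁ * α ^ 2) := by
      rw [abs_mul, abs_of_pos (by positivity : 0 < μ / 2)]
      gcongr
    have h2 : μ / 4 * z ^ 2 ≤ μ / 4 * ((c + C₁) ^ 2 * α ^ 2) := by gcongr
    have h3 : μ / 24 * (μ * z * (3 + 3 * z + z ^ 2)) ≤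
        μ / 24 * ((c * α) * ((c + C₁) * α) * (3 + 3 * L + L ^ 2)) := by gcongr
    have h2' : 0 ≤ μ / 4 * z ^ 2 := by positivity
    have h3' : 0 ≤ μ / 24 * (μ * z * (3 + 3 * z + z ^ 2)) := by positivity
    have h4 : 0 ≤ C₁ * μ * α ^ 2 := by positivity
    have h5 : 0 ≤ (c + C₁) ^ 2 * μ * α ^ 2 := by positivity
    have h6 : 0 ≤ c * (c + C₁) * (3 + 3 * L + L ^ 2) * μ * α ^ 2 := by
      have : 0 ≤ L := by linarith
      positivity
    have hexpand : C * μ * α ^ 2 = C₂ * μ * α ^ 2 + C₁ * μ * α ^ 2 + (c + C₁) ^ 2 * μ * α ^ 2 +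
        c * (c + C₁) * (3 + 3 * L + L ^ 2) * μ * α ^ 2 := by rw [hC]; ring
    rw [e, hexpand]
    rw [abs_le] at hY h1 ⊢
    constructor <;> linarith [hY.1, hY.2, h1.1, h1.2]
  have hαeq : α / π = μ * (1 + z) / lam := by
    rw [hμX]; field_simp
  have hfac : 1 / (2 * lam) * (Y / (1 + z)) - α / (8 * π) - α ^ 2 * lam / (48 * π ^ 2) =
      (Y - μ * (1 + z) ^ 2 / 4 - μ ^ 2 * (1 + z) ^ 3 / 24) / (2 * lam * (1 + z)) := by
    have e1 : α / (8 * π) = (α / π) / 8 := by field_simp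
    have e2 : α ^ 2 * lam / (48 * π ^ 2) = (α / π) ^ 2 * lam / 48 := by field_simp
    rw [e1, e2, hαeq]
    field_simp
    ring
  have hCμ : 0 ≤ C * μ * α ^ 2 := (abs_nonneg _).trans hrem
  have hC0 : 0 ≤ C := by
    by_contra! hneg
    have : 0 < μ * α ^ 2 := by positivity
    nlinarith
  rw [hfac, abs_div, abs_of_pos (by positivity : 0 < 2 * lam * (1 + z)),
    div_le_iff₀ (by positivity)]
  refine hrem.trans ?_
  have hμα : μ ≤ 2 * lam * α * (1 + z) := by
    have h1 : μ ≤ μ * (1 + z) := by nlinarith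
    have h2 : lam * α / π ≤ lam * α := div_le_self (by positivity) (by linarith [Real.pi_gt_three])
    have h3 : 0 ≤ lam * α * z := by positivity
    have h4 : 0 < lam * α := by positivity
    nlinarith
  calc C * μ * α ^ 2 ≤ C * (2 * lam * α * (1 + z)) * α ^ 2 := by gcongr
    _ = C * α ^ 3 * (2 * lam * (1 + z)) := by ring

/-- A solution of `-Δu = μ eᵘ` with `μ ∫ u eᵘ ≤ A` is at most `2 + A` everywhere. -/
lemma le_of_integral_le {Ω : Set R2} (ho : IsOpen Ω) (hb : Bornology.IsBounded Ω) {u : R2 → ℝ}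
    {μ A : ℝ} (hμ : 0 < μ) (hu : ContDiffOn ℝ 2 u Ω) (huc : ContinuousOn u (closure Ω))
    (hbd : ∀ p ∈ frontier Ω, u p = 0) (heq : ∀ p ∈ Ω, lap u p = -(μ * rexp (u p)))
    (hnn : ∀ p ∈ Ω, 0 ≤ u p) (hA : μ * ∫ p in Ω, u p * rexp (u p) ≤ A) (hA0 : 0 ≤ A) :
    ∀ p ∈ Ω, u p ≤ 2 + A := by
  intro p hp
  obtain ⟨x, hx, hmax⟩ := hb.isCompact_closure.exists_isMaxOn ⟨p, subset_closure hp⟩ huc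
  have hle : ∀ q ∈ Ω, u q ≤ u x := fun q hq => hmax (subset_closure hq)
  refine (hle p hp).trans ?_
  by_cases hxΩ : x ∈ Ω
  · exact max_le_of_integral_le ho hb hμ hu huc hbd heq hnn hle hxΩ rfl hA hA0
  · rw [hbd x (by rw [ho.frontier_eq]; exact ⟨hx, hxΩ⟩)]
    linarith

lemma energyE_eq (Ω : Set R2) (lam : ℝ) (u : R2 → ℝ) :
    energyE Ω lam u =
      1 / (2 * lam) * ((∫ p in Ω, u p * rexp (u p)) / ∫ p in Ω, rexp (u p)) := by
  rw [energyE, ← integral_div]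
  congr 2
  ext p
  ring

lemma integral_one_ellipseO {α : ℝ} (hα : 0 < α) : ∫ _ in ellipseO α, (1 : ℝ) = π / α := by
  simpa using integral_ellipseO hα 1 0 0 0

/-- Expansion of the averages of `eᵘ` and `u eᵘ` over the ellipse `ω_α` for bounded solutions of
`-Δu = μ eᵘ`. -/
lemma averages_expansion {α μ L c K : ℝ} (hα : 0 < α) (hα1 : α ≤ 1) (hμ : 0 < μ) (hL : 1 ≤ L)
    (hμL : μ * L ≤ 1) (hμc : μ ≤ c * α) (hK : K = 2 * L ^ 2 * c ^ 2 + 4) {u : R2 → ℝ}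
    (hu : ContDiffOn ℝ 2 u (ellipseO α))
    (huc : ContinuousOn u (closure (ellipseO α))) (hbd : ∀ p ∈ frontier (ellipseO α), u p = 0)
    (heq : ∀ p ∈ ellipseO α, lap u p = -(μ * rexp (u p)))
    (hnn : ∀ p ∈ ellipseO α, 0 ≤ u p) (hub : ∀ p ∈ ellipseO α, rexp (u p) ≤ L) :
    |(∫ p in ellipseO α, rexp (u p)) / (π / α) - (1 + μ / 4)| ≤
        (c ^ 2 * L ^ 2 + c ^ 2 + K) * α ^ 2 ∧
      |(∫ p in ellipseO α, u p * rexp (u p)) / (π / α) - (μ / 4 + μ ^ 2 / 6)| ≤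
        (c ^ 2 * L ^ 3 + K + 2 * L * (c ^ 2 + K)) * μ * α ^ 2 := by
  have hN : 0 < π / α := by positivity
  have hcont := continuous_ellipseFun α
  have hb := isBounded_ellipseO hα
  have hpt : ∀ p ∈ ellipseO α, _ := fun p hp => by
    obtain ⟨h0, h1, -, -, h4, h5⟩ := ellipse_coord_bounds hp
    obtain ⟨huL, hexp⟩ := solution_expansion hα hα1 hμ hL hμL hμc hu huc hbd heq hnn hub p hp
    rw [← hK, barrier] at hexp
    have hμ2 : μ ^ 2 ≤ c ^ 2 * α ^ 2 := by
      rw [← mul_pow]; exact pow_le_pow_left₀ hμ.le hμc 2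
    exact abs_exp_sub_le hμ (by nlinarith) hμ2 (by rw [hK]; positivity) hL h0.le h1
      (by positivity) (by nlinarith [mul_le_mul h1 h5 h4 zero_le_one]) (hnn p hp) huL hμL hexp
  have haverage : ∀ {S G k : ℝ}, |S - π / α * G| ≤ k * (π / α) → |S / (π / α) - G| ≤ k := by
    intro S G k h
    rw [← mul_le_mul_iff_of_pos_right hN]
    refine le_trans (le_of_eq ?_) h
    rw [← abs_of_pos hN, ← abs_mul, abs_of_pos hN]
    congr 1
    field_simp
  constructor
  · have h := abs_setIntegral_sub_le hb (huc.rexp) (g := fun p => 1 + μ / 2 * ellipseFun α p)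
      (by fun_prop) fun p hp => (hpt p hp).1
    have hint := integral_ellipseO hα 1 (μ / 2) 0 0
    simp only [zero_mul, add_zero] at hint
    rw [integral_one_ellipseO hα, hint] at h
    refine haverage (le_trans (le_of_eq ?_) h)
    ring_nf
  · have h := abs_setIntegral_sub_le hb (huc.mul huc.rexp)
      (g := fun p => μ / 2 * ellipseFun α p +
        μ ^ 2 * ((5 * ellipseFun α p ^ 2 + 4 * ellipseFun α p * p 1 ^ 2) / 24) +
          μ ^ 2 / 4 * ellipseFun α p ^ 2)
      (by fun_prop) fun p hp => (hpt p hp).2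
    have hint : ∫ p in ellipseO α, (μ / 2 * ellipseFun α p +
        μ ^ 2 * ((5 * ellipseFun α p ^ 2 + 4 * ellipseFun α p * p 1 ^ 2) / 24) +
          μ ^ 2 / 4 * ellipseFun α p ^ 2) = π / α * (μ / 4 + μ ^ 2 / 6) := by
      trans ∫ p in ellipseO α, (0 + μ / 2 * ellipseFun α p + 11 * μ ^ 2 / 24 * ellipseFun α p ^ 2 +
        μ ^ 2 / 6 * (ellipseFun α p * p 1 ^ 2))
      · congr 1
        ext p
        ring
      · rw [integral_ellipseO hα]
        ring
    rw [integral_one_ellipseO hα, hint] at h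
    exact haverage h

/-- Energy expansion on thin ellipses: `ℰ(u) = α/(8π) + α²λ/(48π²) + O(α³)` for solutions of
`P(λ, ω_α)` with `λ ≤ λ̄` and `ℰ(u) ≤ 1`. -/
theorem statement12 (lamBar : ℝ) (h : 8 * π ≤ lamBar) :
    ∃ α₁ C : ℝ, 0 < α₁ ∧ 0 < C ∧
      ∀ α ∈ Set.Ioc (0 : ℝ) α₁, ∀ lam ∈ Set.Ioc (0 : ℝ) lamBar, ∀ u : R2 → ℝ,
        IsSolP (ellipseO α) lam u → energyE (ellipseO α) lam u ≤ 1 →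
        |energyE (ellipseO α) lam u - α / (8 * π) - α ^ 2 * lam / (48 * π ^ 2)| ≤
          C * α ^ 3 := by
  have hBar : 0 < lamBar := lt_of_lt_of_le (by positivity) h
  obtain ⟨c, hc⟩ : ∃ c, c = lamBar / π := ⟨_, rfl⟩
  obtain ⟨L, hLdef⟩ : ∃ L, L = rexp (2 + 2 * lamBar ^ 2) := ⟨_, rfl⟩
  obtain ⟨K, hK⟩ : ∃ K, K = 2 * L ^ 2 * c ^ 2 + 4 := ⟨_, rfl⟩
  obtain ⟨C₁, hC₁⟩ : ∃ C₁, C₁ = c ^ 2 * L ^ 2 + c ^ 2 + K := ⟨_, rfl⟩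
  obtain ⟨C₂, hC₂⟩ : ∃ C₂, C₂ = c ^ 2 * L ^ 3 + K + 2 * L * (c ^ 2 + K) := ⟨_, rfl⟩
  have hcpos : 0 < c := by rw [hc]; positivity
  have hL : 1 ≤ L := by rw [hLdef]; exact Real.one_le_exp (by positivity)
  have hLpos : 0 < L := by linarith
  have hKpos : 0 < K := by rw [hK]; positivity
  have hC₁pos : 0 < C₁ := by rw [hC₁]; positivity
  have hC₂pos : 0 < C₂ := by rw [hC₂]; positivity
  refine ⟨min 1 (1 / (c * L)),
    C₂ + C₁ + (c + C₁) ^ 2 + c * (c + C₁) * (3 + 3 * L + L ^ 2), by positivity, by positivity, ?_⟩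
  rintro α ⟨hα, hαle⟩ lam ⟨hlam, hlamle⟩ u ⟨hu, huc, hbd, hpde⟩ hE
  have hα1 : α ≤ 1 := hαle.trans (min_le_left _ _)
  have hαcL : α * (c * L) ≤ 1 := (le_div_iff₀ (by positivity)).1 (hαle.trans (min_le_right _ _))
  have ho := isOpen_ellipseO α
  have hb := isBounded_ellipseO hα
  have hN : 0 < π / α := by positivity
  have hone := integral_one_ellipseO hα
  have hvol : volume (ellipseO α) ≠ 0 := fun h0 => by
    rw [setIntegral_measure_zero _ h0] at hone
    exact hN.ne hone
  have hinte : IntegrableOn (fun p => rexp (u p)) (ellipseO α) :=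
    (huc.rexp.integrableOn_compact hb.isCompact_closure).mono_set subset_closure
  rw [energyE_eq] at hE ⊢
  set I := ∫ p in ellipseO α, rexp (u p) with hI
  set S := ∫ p in ellipseO α, u p * rexp (u p) with hS
  have hIpos : 0 < I := by
    rw [hI, setIntegral_pos_iff_support_of_nonneg_ae (ae_of_all _ fun p => (exp_pos _).le) hinte]
    have hsupp : Function.support (fun p => rexp (u p)) = univ := by
      ext p; simp [Real.exp_ne_zero]
    rw [hsupp, univ_inter]
    exact pos_iff_ne_zero.2 hvol
  obtain ⟨μ, hμdef⟩ : ∃ μ, μ = lam / I := ⟨_, rfl⟩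
  have hμ : 0 < μ := by rw [hμdef]; positivity
  have heq : ∀ p ∈ ellipseO α, lap u p = -(μ * rexp (u p)) := fun p hp => by
    rw [← neg_eq_iff_eq_neg, hpde p hp, hμdef]
    ring
  have hnn : ∀ p ∈ ellipseO α, 0 ≤ u p := fun p hp =>
    nonneg_of_lap_neg ho hb hu huc hbd
      (fun q hq => by rw [heq q hq, neg_lt_zero]; positivity) p (subset_closure hp)
  have hNI : π / α ≤ I := by
    rw [← hone]
    refine setIntegral_mono_on ?_ hinte ho.measurableSet fun p hp => Real.one_le_exp (hnn p hp)
    exact integrableOn_const hb.measure_lt_top.ne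
  have hμI : μ * I = lam := by rw [hμdef]; field_simp
  have hμX : μ * (I / (π / α)) = lam * α / π := by
    rw [← mul_div_assoc, hμI]; field_simp
  have hX1 : 1 ≤ I / (π / α) := (one_le_div hN).2 hNI
  have hμc : μ ≤ c * α := by
    calc μ ≤ μ * (I / (π / α)) := le_mul_of_one_le_right hμ.le hX1
      _ = lam * α / π := hμX
      _ ≤ lamBar * α / π := by gcongr
      _ = c * α := by rw [hc]; ring
  have hμL : μ * L ≤ 1 := by
    calc μ * L ≤ c * α * L := by gcongr
      _ = α * (c * L) := by ring
      _ ≤ 1 := hαcL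
  have hA : μ * S ≤ 2 * lamBar ^ 2 := by
    have h1 : S / I ≤ 2 * lam := by
      rwa [one_div_mul_eq_div, div_le_one (by positivity)] at hE
    calc μ * S = lam * (S / I) := by rw [hμdef]; ring
      _ ≤ lam * (2 * lam) := by gcongr
      _ ≤ lamBar * (2 * lamBar) := by gcongr
      _ = 2 * lamBar ^ 2 := by ring
  have hub : ∀ p ∈ ellipseO α, rexp (u p) ≤ L := fun p hp => by
    rw [hLdef, Real.exp_le_exp]
    exact le_of_integral_le ho hb hμ hu huc hbd heq hnn hA (by positivity) p hp
  have hXL : I / (π / α) ≤ L := by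
    rw [div_le_iff₀ hN, ← hone, ← integral_const_mul]
    refine setIntegral_mono_on hinte ?_ ho.measurableSet fun p hp => by simpa using hub p hp
    exact integrableOn_const hb.measure_lt_top.ne
  obtain ⟨hX, hY⟩ := averages_expansion hα hα1 hμ hL hμL hμc hK hu huc hbd heq hnn hub
  rw [← hC₁] at hX
  rw [← hC₂] at hY
  have key := energy_expansion_of_averages hα hα1 hlam hμ hμc hcpos.le hX1 hXL hC₁pos.le hμX hX hY
  rwa [div_div_div_cancel_right₀ hN.ne'] at key
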